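/- arXiv:2603.05175 — 3 statements merged into one kernel-verified Lean document; each statement's English description precedes it below -/
import Mathlib

section
/- There exists an implementable regulation mechanism for the set P0 of non-compliant distributions if and only if P0 is a credal set, i.e., P0 is convex and closed in the topology of weak convergence on the space of Borel probability measures on Z. -/
open MeasureTheory

/-- A license: a continuous function `Z → [0, R]`. -/
def IsLicense {Z : Type*} [TopologicalSpace Z] (R : ℝ) (π : Z → ℝ) : Prop :=
  Continuous π ∧ ∀ z, π z ∈ Set.Icc (0 : ℝ) R

/-- A regulation mechanism (a set of functions) consists only of licenses. -/
def IsMechanism {Z : Type*} [TopologicalSpace Z] (R : ℝ) (M : Set (Z → ℝ)) : Prop :=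
  ∀ π ∈ M, IsLicense R π

/-- Obedience: every non-compliant distribution gets expected payout at most `C`
from every license. -/
def Obedient {Z : Type*} [TopologicalSpace Z] [MeasurableSpace Z] (C : ℝ)
    (P0 : Set (ProbabilityMeasure Z)) (M : Set (Z → ℝ)) : Prop :=
  ∀ P ∈ P0, ∀ π ∈ M, ∫ z, π z ∂(P : Measure Z) ≤ C

/-- Feasibility: every compliant distribution has some license with expected payout
exceeding `C`. -/
def Feasible {Z : Type*} [TopologicalSpace Z] [MeasurableSpace Z] (C : ℝ)
    (P0 : Set (ProbabilityMeasure Z)) (M : Set (Z → ℝ)) : Prop :=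
  ∀ P : ProbabilityMeasure Z, P ∉ P0 → ∃ π ∈ M, C < ∫ z, π z ∂(P : Measure Z)

/-- Implementability: a mechanism of licenses that is both obedient and feasible. -/
def Implementable {Z : Type*} [TopologicalSpace Z] [MeasurableSpace Z] (C R : ℝ)
    (P0 : Set (ProbabilityMeasure Z)) (M : Set (Z → ℝ)) : Prop :=
  IsMechanism R M ∧ Obedient C P0 M ∧ Feasible C P0 M

/-- Convexity of a set of probability measures: it is stable under mixtures. -/
def ConvexPM {Z : Type*} [MeasurableSpace Z] (P0 : Set (ProbabilityMeasure Z)) : Prop :=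
  ∀ P₁ ∈ P0, ∀ P₂ ∈ P0, ∀ a b : NNReal, a + b = 1 →
    ∀ Q : ProbabilityMeasure Z,
      (Q : Measure Z) = a • (P₁ : Measure Z) + b • (P₂ : Measure Z) → Q ∈ P0

open Filter Topology BoundedContinuousFunction in
/-- Integration against a probability measure as a linear functional. -/
noncomputable def integralLM {Z : Type*} [TopologicalSpace Z] [MeasurableSpace Z] [OpensMeasurableSpace Z]
    (P : ProbabilityMeasure Z) : BoundedContinuousFunction Z ℝ →ₗ[ℝ] ℝ where
  toFun f := ∫ z, f z ∂(P : Measure Z)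
  map_add' f g := by
    simpa using integral_add (f.integrable (P : Measure Z)) (g.integrable (P : Measure Z))
  map_smul' c f := by
    simpa using integral_const_mul c (fun z => f z)

/-- The evaluation pairing. -/
noncomputable abbrev evalPairing (Z : Type*) [TopologicalSpace Z] :
    (BoundedContinuousFunction Z ℝ →ₗ[ℝ] ℝ) →ₗ[ℝ] BoundedContinuousFunction Z ℝ →ₗ[ℝ] ℝ :=
  LinearMap.id

/-- Integration functional, in the weak topology. -/
noncomputable def integralW {Z : Type*} [TopologicalSpace Z] [MeasurableSpace Z]
    [OpensMeasurableSpace Z] (P : ProbabilityMeasure Z) : WeakBilin (evalPairing Z) :=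
  integralLM P

open Filter Topology in
theorem integralW_isInducing {Z : Type*} [TopologicalSpace Z] [MeasurableSpace Z]
    [OpensMeasurableSpace Z] : IsInducing (integralW (Z := Z)) := by
  have hinj : Function.Injective (evalPairing Z) := fun _ _ h => h
  rw [isInducing_iff_nhds]
  intro P
  apply le_antisymm
  · rw [← tendsto_iff_comap, WeakBilin.tendsto_iff_forall_eval_tendsto _ hinj]
    exact ProbabilityMeasure.tendsto_iff_forall_integral_tendsto.1 tendsto_id
  · have h : Tendsto (id : ProbabilityMeasure Z → _) (comap integralW (𝓝 (integralW P))) (𝓝 P) := by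
      rw [ProbabilityMeasure.tendsto_iff_forall_integral_tendsto]
      exact (WeakBilin.tendsto_iff_forall_eval_tendsto _ hinj).1 tendsto_comap
    exact h

theorem exists_separating {Z : Type*} [TopologicalSpace Z] [MeasurableSpace Z]
    [OpensMeasurableSpace Z] (P0 : Set (ProbabilityMeasure Z)) (hconv : ConvexPM P0)
    (hcl : IsClosed P0) (Q : ProbabilityMeasure Z) (hQ : Q ∉ P0) :
    ∃ (g : BoundedContinuousFunction Z ℝ) (u : ℝ),
      (∀ P ∈ P0, ∫ z, g z ∂(P : Measure Z) < u) ∧ u < ∫ z, g z ∂(Q : Measure Z) := by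
  have hc : Convex ℝ (integralW '' P0) := by
    rintro _ ⟨P₁, h₁, rfl⟩ _ ⟨P₂, h₂, rfl⟩ a b ha hb hab
    lift a to NNReal using ha
    lift b to NNReal using hb
    have hab' : a + b = 1 := by exact_mod_cast hab
    have hp : IsProbabilityMeasure (a • (P₁ : Measure Z) + b • (P₂ : Measure Z)) := by
      constructor
      simp only [Measure.add_apply, Measure.smul_apply, measure_univ]
      simp only [ENNReal.smul_def, smul_eq_mul, mul_one]
      exact_mod_cast hab'
    refine ⟨⟨_, hp⟩, hconv P₁ h₁ P₂ h₂ a b hab' _ rfl, ?_⟩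
    refine LinearMap.ext fun f => ?_
    change ∫ z, f z ∂(a • (P₁ : Measure Z) + b • (P₂ : Measure Z)) =
      (a : ℝ) * ∫ z, f z ∂(P₁ : Measure Z) + (b : ℝ) * ∫ z, f z ∂(P₂ : Measure Z)
    rw [integral_add_measure ((f.integrable _).smul_measure_nnreal)
      ((f.integrable _).smul_measure_nnreal), integral_smul_nnreal_measure,
      integral_smul_nnreal_measure]
    rfl
  have hn : integralW Q ∉ closure (integralW '' P0) := by
    intro h
    apply hQ
    rw [← hcl.closure_eq, integralW_isInducing.closure_eq_preimage_closure_image]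
    exact h
  obtain ⟨l, u, hl, hu⟩ := geometric_hahn_banach_closed_point hc.closure isClosed_closure hn
  obtain ⟨g, rfl⟩ := LinearMap.dualEmbedding_surjective (evalPairing Z) l
  exact ⟨g, u, fun P hP => hl _ (subset_closure ⟨P, hP, rfl⟩), hu⟩

theorem exists_license {Z : Type*} [TopologicalSpace Z] [MeasurableSpace Z]
    [OpensMeasurableSpace Z] (C R : ℝ) (hC : 0 < C) (hCR : C < R)
    (g : BoundedContinuousFunction Z ℝ) (u : ℝ) :
    ∃ π : Z → ℝ, IsLicense R π ∧ ∃ ε > 0, ∀ P : ProbabilityMeasure Z,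
      ∫ z, π z ∂(P : Measure Z) = C + ε * (∫ z, g z ∂(P : Measure Z) - u) := by
  set K := ‖g‖ + |u| + 1 with hK
  have hKpos : 0 < K := by positivity
  set m := min C (R - C) with hm
  have hmpos : 0 < m := lt_min hC (by linarith)
  have hm1 : m ≤ C := min_le_left _ _
  have hm2 : m ≤ R - C := min_le_right _ _
  have hε : 0 < m / K := by positivity
  refine ⟨fun z => C + m / K * (g z - u), ⟨by fun_prop, fun z => ?_⟩, m / K, hε, fun P => ?_⟩
  · have h1 : |g z - u| ≤ K := by
      have := g.norm_coe_le_norm z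
      rw [Real.norm_eq_abs] at this
      have := abs_sub (g z) u
      linarith
    have h2 : |m / K * (g z - u)| ≤ m := by
      rw [abs_mul, abs_of_pos hε]
      calc m / K * |g z - u| ≤ m / K * K := by gcongr
        _ = m := by field_simp
    have := abs_le.1 h2
    constructor <;> dsimp only <;> linarith
  · have hg := g.integrable (P : Measure Z)
    have hi : Integrable (fun z => m / K * (g z - u)) (P : Measure Z) :=
      (hg.sub (integrable_const u)).const_mul _
    change ∫ z, (C + m / K * (g z - u)) ∂(P : Measure Z) = _
    rw [integral_add (integrable_const _) hi,
      integral_const_mul, integral_sub hg (integrable_const _)]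
    simp

/-- There exists an implementable regulation mechanism for the set `P0`
of non-compliant distributions if and only if `P0` is a credal set, i.e. convex and
closed in the topology of weak convergence on probability measures. -/
theorem exists_implementable_iff_credal
    {Z : Type*} [MetricSpace Z] [CompactSpace Z] [MeasurableSpace Z] [BorelSpace Z]
    (C R : ℝ) (hC : 0 < C) (hCR : C < R)
    (P0 : Set (ProbabilityMeasure Z)) :
    (∃ M : Set (Z → ℝ), Implementable C R P0 M) ↔ (ConvexPM P0 ∧ IsClosed P0) := by
  constructor
  · rintro ⟨M, hM, hO, hF⟩
    have key : P0 = ⋂ π ∈ M, {P : ProbabilityMeasure Z | ∫ z, π z ∂(P : Measure Z) ≤ C} := by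
      ext P
      simp only [Set.mem_iInter, Set.mem_ofPred_eq]
      refine ⟨fun h => hO P h, fun h => ?_⟩
      by_contra hP
      obtain ⟨π, hπ, hlt⟩ := hF P hP
      exact absurd (h π hπ) (not_le.2 hlt)
    constructor
    · intro P₁ h₁ P₂ h₂ a b hab Q hQ
      by_contra hn
      obtain ⟨π, hπ, hlt⟩ := hF Q hn
      let f : BoundedContinuousFunction Z ℝ :=
        BoundedContinuousFunction.mkOfCompact ⟨π, (hM π hπ).1⟩
      have hi (P : ProbabilityMeasure Z) : Integrable π (P : Measure Z) := f.integrable _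
      rw [hQ, integral_add_measure (hi _).smul_measure_nnreal (hi _).smul_measure_nnreal,
        integral_smul_nnreal_measure, integral_smul_nnreal_measure, NNReal.smul_def,
        NNReal.smul_def, smul_eq_mul, smul_eq_mul] at hlt
      have e1 := mul_le_mul_of_nonneg_left (hO P₁ h₁ π hπ) a.coe_nonneg
      have e2 := mul_le_mul_of_nonneg_left (hO P₂ h₂ π hπ) b.coe_nonneg
      have hab' : (a : ℝ) + b = 1 := by exact_mod_cast hab
      have : (a : ℝ) * C + b * C = C := by rw [← add_mul, hab', one_mul]
      linarith
    · rw [key]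
      refine isClosed_biInter fun π hπ => ?_
      let f : C(Z, ℝ) := ⟨π, (hM π hπ).1⟩
      exact isClosed_le (ProbabilityMeasure.continuous_integral_continuousMap f) continuous_const
  · rintro ⟨hconv, hcl⟩
    refine ⟨{π | IsLicense R π ∧ ∀ P ∈ P0, ∫ z, π z ∂(P : Measure Z) ≤ C}, fun π h => h.1,
      fun P hP π h => h.2 P hP, fun Q hQ => ?_⟩
    obtain ⟨g, u, hl, hu⟩ := exists_separating P0 hconv hcl Q hQ
    obtain ⟨π, hπ, ε, hε, hint⟩ := exists_license C R hC hCR g u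
    refine ⟨π, ⟨hπ, fun P hP => ?_⟩, ?_⟩
    · rw [hint]
      have := mul_nonneg hε.le (sub_nonneg.2 (hl P hP).le)
      linarith
    · rw [hint]
      have := mul_pos hε (sub_pos.2 hu)
      linarith
end

section
/- Let r : Δ(Z) → ℝ be a functional on probability measures, and for each threshold τ ∈ ℝ let P0^τ := {P ∈ Δ(Z) : r(P) ≤ τ} be the corresponding set of non-compliant distributions. Then there exists an implementable regulation mechanism for P0^τ for every τ ∈ ℝ if and only if r is quasi-convex (r(λP1 + (1−λ)P2) ≤ max{r(P1), r(P2)} for all P1, P2 ∈ Δ(Z) and λ ∈ [0,1]) and lower semi-continuous with respect to the topology of weak convergence (equivalently, every sublevel set {P : r(P) ≤ τ} is weakly closed). -/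
open MeasureTheory

/-- Quasi-convexity of a functional on probability measures:
`r (λ P₁ + (1-λ) P₂) ≤ max (r P₁) (r P₂)` for all mixtures. -/
def QuasiConvexPM {Z : Type*} [MeasurableSpace Z] (r : ProbabilityMeasure Z → ℝ) : Prop :=
  ∀ P₁ P₂ : ProbabilityMeasure Z, ∀ a b : NNReal, a + b = 1 →
    ∀ Q : ProbabilityMeasure Z,
      (Q : Measure Z) = a • (P₁ : Measure Z) + b • (P₂ : Measure Z) →
        r Q ≤ max (r P₁) (r P₂)

open Filter Topology BoundedContinuousFunction in
/-- Separation of a point from a weakly closed, mixture-closed set of probability measures. -/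
lemma exists_separating_s1 {Z : Type*} [MetricSpace Z] [CompactSpace Z] [MeasurableSpace Z]
    [BorelSpace Z] (S : Set (ProbabilityMeasure Z)) (hS : IsClosed S)
    (hconv : ∀ P₁ ∈ S, ∀ P₂ ∈ S, ∀ a b : NNReal, a + b = 1 → ∀ Q : ProbabilityMeasure Z,
      (Q : Measure Z) = a • (P₁ : Measure Z) + b • (P₂ : Measure Z) → Q ∈ S)
    (P : ProbabilityMeasure Z) (hP : P ∉ S) :
    ∃ (g : Z →ᵇ ℝ) (u : ℝ), (∀ Q ∈ S, ∫ z, g z ∂(Q : Measure Z) < u) ∧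
      u < ∫ z, g z ∂(P : Measure Z) := by
  let T : ProbabilityMeasure Z → ((Z →ᵇ ℝ) → ℝ) := fun Q f => ∫ z, f z ∂(Q : Measure Z)
  have hle : comap T (𝓝 (T P)) ≤ 𝓝 P := by
    have : Tendsto id (comap T (𝓝 (T P))) (𝓝 P) := by
      rw [ProbabilityMeasure.tendsto_iff_forall_integral_tendsto]
      intro f
      exact ((continuous_apply f).tendsto (T P)).comp tendsto_comap
    simpa [Tendsto] using this
  have hnot : T P ∉ closure (T '' S) := by
    obtain ⟨V, hV, hVS⟩ := hle (hS.isOpen_compl.mem_nhds hP)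
    rw [mem_closure_iff_nhds]
    intro h
    obtain ⟨_, hx, ⟨Q, hQ, rfl⟩⟩ := h V hV
    exact hVS hx hQ
  have hcv : Convex ℝ (T '' S) := by
    rintro _ ⟨P₁, h₁, rfl⟩ _ ⟨P₂, h₂, rfl⟩ a b ha hb hab
    lift a to NNReal using ha
    lift b to NNReal using hb
    have hab' : a + b = 1 := by exact_mod_cast hab
    have hprob : IsProbabilityMeasure (a • (P₁ : Measure Z) + b • (P₂ : Measure Z)) := by
      constructor
      simp only [Measure.add_apply, Measure.smul_apply, measure_univ]
      simp only [ENNReal.smul_def, smul_eq_mul, mul_one]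
      exact_mod_cast hab'
    refine ⟨⟨_, hprob⟩, hconv P₁ h₁ P₂ h₂ a b hab' _ rfl, ?_⟩
    funext f
    change ∫ z, f z ∂(a • (P₁ : Measure Z) + b • (P₂ : Measure Z)) = _
    rw [integral_add_measure ((f.integrable _).smul_measure_nnreal)
      ((f.integrable _).smul_measure_nnreal), integral_smul_nnreal_measure,
      integral_smul_nnreal_measure]
    rfl
  obtain ⟨φ, u, h1, h2⟩ := geometric_hahn_banach_closed_point hcv.closure isClosed_closure hnot
  have hspan : (φ : ((Z →ᵇ ℝ) → ℝ) →ₗ[ℝ] ℝ) ∈ Submodule.span ℝ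
      (Set.range (fun f : Z →ᵇ ℝ => (LinearMap.proj f : ((Z →ᵇ ℝ) → ℝ) →ₗ[ℝ] ℝ))) := by
    rw [LinearMap.mem_span_iff_continuous]
    exact φ.continuous
  have hrep : ∃ g : Z →ᵇ ℝ, ∀ Q, (φ : ((Z →ᵇ ℝ) → ℝ) →ₗ[ℝ] ℝ) (T Q)
      = ∫ z, g z ∂(Q : Measure Z) := by
    generalize (φ : ((Z →ᵇ ℝ) → ℝ) →ₗ[ℝ] ℝ) = ψ at hspan
    induction hspan using Submodule.span_induction with
    | mem x hx =>
      obtain ⟨f, rfl⟩ := hx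
      exact ⟨f, fun Q => rfl⟩
    | zero => exact ⟨0, fun Q => by simp⟩
    | add x y _ _ hx hy =>
      obtain ⟨f, hf⟩ := hx
      obtain ⟨g, hg⟩ := hy
      refine ⟨f + g, fun Q => ?_⟩
      simp only [LinearMap.add_apply, hf, hg, BoundedContinuousFunction.coe_add, Pi.add_apply]
      rw [integral_add (f.integrable _) (g.integrable _)]
    | smul c x _ hx =>
      obtain ⟨f, hf⟩ := hx
      refine ⟨c • f, fun Q => ?_⟩
      simp only [LinearMap.smul_apply, hf, BoundedContinuousFunction.coe_smul]
      rw [integral_smul]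
  obtain ⟨g, hg⟩ := hrep
  refine ⟨g, u, fun Q hQ => ?_, ?_⟩
  · rw [← hg]
    exact h1 _ (subset_closure ⟨Q, hQ, rfl⟩)
  · rw [← hg]
    exact h2

open BoundedContinuousFunction in
/-- Affine rescaling of a separating function to a license. -/
lemma exists_license_s1 {Z : Type*} [MetricSpace Z] [CompactSpace Z] [MeasurableSpace Z]
    [BorelSpace Z] (C R : ℝ) (hC : 0 < C) (hCR : C < R) (S : Set (ProbabilityMeasure Z))
    (P : ProbabilityMeasure Z) (g : Z →ᵇ ℝ) (u : ℝ)
    (h1 : ∀ Q ∈ S, ∫ z, g z ∂(Q : Measure Z) < u) (h2 : u < ∫ z, g z ∂(P : Measure Z)) :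
    ∃ π : Z → ℝ, IsLicense R π ∧ (∀ Q ∈ S, ∫ z, π z ∂(Q : Measure Z) ≤ C) ∧
      C < ∫ z, π z ∂(P : Measure Z) := by
  set K : ℝ := ‖g‖ + |u| + 1 with hK
  have hKpos : 0 < K := by positivity
  set m : ℝ := min C (R - C) with hm
  have hmpos : 0 < m := lt_min hC (by linarith)
  set ε : ℝ := m / K with hε
  have hεpos : 0 < ε := div_pos hmpos hKpos
  have hεK : ε * K = m := by rw [hε]; field_simp
  have hint : ∀ Q : ProbabilityMeasure Z, ∫ z, (C + ε * (g z - u)) ∂(Q : Measure Z)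
      = C + ε * (∫ z, g z ∂(Q : Measure Z) - u) := by
    intro Q
    have hi := g.integrable (Q : Measure Z)
    have hi2 : Integrable (fun z => ε * (g z - u)) (Q : Measure Z) :=
      (hi.sub (integrable_const _)).const_mul _
    rw [integral_add (integrable_const _) hi2,
      integral_const_mul, integral_sub hi (integrable_const _)]
    simp
  refine ⟨fun z => C + ε * (g z - u), ⟨by fun_prop, fun z => ?_⟩, fun Q hQ => ?_, ?_⟩
  · have hb : |g z - u| ≤ K := by
      have := g.norm_coe_le_norm z
      rw [Real.norm_eq_abs] at this
      have := abs_sub (g z) u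
      linarith
    have hb' : |ε * (g z - u)| ≤ m := by
      rw [abs_mul, abs_of_pos hεpos, ← hεK]
      gcongr
    have := abs_le.1 hb'
    have := min_le_left C (R - C)
    have := min_le_right C (R - C)
    constructor <;> linarith
  · rw [hint]
    have := h1 Q hQ
    nlinarith
  · rw [hint]
    nlinarith

/-- For threshold-based requirements, an implementable mechanism exists
for every threshold `τ` if and only if the metric `r` is quasi-convex and lower
semi-continuous with respect to the topology of weak convergence. -/
theorem exists_implementable_all_thresholds_iff_quasiConvex_lsc
    {Z : Type*} [MetricSpace Z] [CompactSpace Z] [MeasurableSpace Z] [BorelSpace Z]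
    (C R : ℝ) (hC : 0 < C) (hCR : C < R)
    (r : ProbabilityMeasure Z → ℝ) :
    (∀ τ : ℝ, ∃ M : Set (Z → ℝ),
        Implementable C R {P : ProbabilityMeasure Z | r P ≤ τ} M) ↔
      (QuasiConvexPM r ∧ LowerSemicontinuous r) := by
  constructor
  · intro h
    refine ⟨?_, ?_⟩
    · intro P₁ P₂ a b hab Q hQ
      by_contra hlt
      obtain ⟨M, hM, hob, hfe⟩ := h (max (r P₁) (r P₂))
      obtain ⟨π, hπ, hgt⟩ := hfe Q hlt
      have e1 := hob P₁ (le_max_left (r P₁) (r P₂)) π hπ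
      have e2 := hob P₂ (le_max_right (r P₁) (r P₂)) π hπ
      let f : BoundedContinuousFunction Z ℝ :=
        BoundedContinuousFunction.mkOfCompact ⟨π, (hM π hπ).1⟩
      have i1 : Integrable π (P₁ : Measure Z) := f.integrable _
      have i2 : Integrable π (P₂ : Measure Z) := f.integrable _
      rw [hQ, integral_add_measure i1.smul_measure_nnreal i2.smul_measure_nnreal,
        integral_smul_nnreal_measure, integral_smul_nnreal_measure,
        NNReal.smul_def, NNReal.smul_def, smul_eq_mul, smul_eq_mul] at hgt
      have hab' : (a : ℝ) + b = 1 := by exact_mod_cast hab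
      have f1 := mul_le_mul_of_nonneg_left e1 a.coe_nonneg
      have f2 := mul_le_mul_of_nonneg_left e2 b.coe_nonneg
      have : (a : ℝ) * C + b * C = C := by rw [← add_mul, hab', one_mul]
      linarith
    · rw [lowerSemicontinuous_iff_isClosed_preimage]
      intro τ
      obtain ⟨M, hM, hob, hfe⟩ := h τ
      have : r ⁻¹' Set.Iic τ = ⋂ π ∈ M, {P : ProbabilityMeasure Z | ∫ z, π z ∂(P : Measure Z) ≤ C} := by
        ext P
        simp only [Set.mem_preimage, Set.mem_Iic, Set.mem_iInter, Set.mem_setOf_eq]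
        refine ⟨fun hP π hπ => hob P hP π hπ, fun hP => ?_⟩
        by_contra hlt
        obtain ⟨π, hπ, hgt⟩ := hfe P hlt
        exact absurd (hP π hπ) (not_le.2 hgt)
      rw [this]
      refine isClosed_biInter fun π hπ => isClosed_le ?_ continuous_const
      exact ProbabilityMeasure.continuous_integral_boundedContinuousFunction
        (BoundedContinuousFunction.mkOfCompact ⟨π, (hM π hπ).1⟩)
  · rintro ⟨hq, hl⟩ τ
    refine ⟨{π | IsLicense R π ∧ ∀ Q : ProbabilityMeasure Z, r Q ≤ τ →
      ∫ z, π z ∂(Q : Measure Z) ≤ C}, fun π hπ => hπ.1, fun P hP π hπ => hπ.2 P hP, ?_⟩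
    intro P hP
    obtain ⟨g, u, h1, h2⟩ := exists_separating_s1 {P | r P ≤ τ}
      (lowerSemicontinuous_iff_isClosed_preimage.1 hl τ)
      (fun P₁ h₁ P₂ h₂ a b hab Q hQ => (hq P₁ P₂ a b hab Q hQ).trans (max_le h₁ h₂)) P hP
    obtain ⟨π, hπ, h3, h4⟩ := exists_license_s1 C R hC hCR _ P g u h1 h2
    exact ⟨π, ⟨hπ, h3⟩, h4⟩
end

section
/- Let P and Q be probability measures on a measurable space Z with Q absolutely continuous with respect to P, and let f := dQ/dP be the Radon–Nikodym derivative. Fix R > 0, τ ≥ 0 and γ ∈ [0,1], and define the license π*(z) := R if f(z) > τ, π*(z) := γR if f(z) = τ, and π*(z) := 0 if f(z) < τ. Suppose ∫ π* dP = C. Then for every measurable function π : Z → [0,R] with ∫ π dP ≤ C, one has ∫ π dQ ≤ ∫ π* dQ; i.e., the all-or-nothing license π* maximizes the expected payout under Q among all obedient licenses. -/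
open MeasureTheory

/-- (Neyman–Pearson optimality of all-or-nothing licenses.)
Let `f = dQ/dP` and let `π*` be the license equal to `R` where `f > τ`, to `γR` where
`f = τ`, and to `0` where `f < τ`, with `∫ π* dP = C`.  Then among all measurable
licenses `π : Z → [0,R]` with `∫ π dP ≤ C`, the license `π*` maximizes `∫ π dQ`. -/
theorem all_or_nothing_license_optimal
    {Z : Type*} [MeasurableSpace Z]
    (P Q : Measure Z) [IsProbabilityMeasure P] [IsProbabilityMeasure Q]
    (hQP : Q ≪ P)
    (C R τ γ : ℝ) (hC : 0 < C) (hCR : C < R) (hτ : 0 ≤ τ)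
    (hγ : γ ∈ Set.Icc (0 : ℝ) 1)
    (πstar : Z → ℝ)
    (hπstar : πstar = fun z =>
      if τ < (Q.rnDeriv P z).toReal then R
      else if (Q.rnDeriv P z).toReal = τ then γ * R else 0)
    (hfee : ∫ z, πstar z ∂P = C) :
    ∀ π : Z → ℝ, Measurable π → (∀ z, π z ∈ Set.Icc (0 : ℝ) R) →
      ∫ z, π z ∂P ≤ C → ∫ z, π z ∂Q ≤ ∫ z, πstar z ∂Q := by
  intro π hπ hπR hle
  have hR : 0 < R := hC.trans hCR
  have hf : Measurable (fun z => (Q.rnDeriv P z).toReal) :=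
    (Measure.measurable_rnDeriv Q P).ennreal_toReal
  have hsm : Measurable πstar := by
    rw [hπstar]
    exact Measurable.ite (measurableSet_lt measurable_const hf) measurable_const
      (Measurable.ite (measurableSet_eq_fun hf measurable_const) measurable_const
        measurable_const)
  have hγR : γ * R ∈ Set.Icc (0 : ℝ) R :=
    ⟨mul_nonneg hγ.1 hR.le, by nlinarith [hγ.2]⟩
  have hsR : ∀ z, πstar z ∈ Set.Icc (0 : ℝ) R := by
    intro z
    rw [hπstar]
    dsimp only
    split_ifs
    · exact ⟨hR.le, le_rfl⟩
    · exact hγR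
    · exact ⟨le_rfl, hR.le⟩
  have key : ∀ (μ : Measure Z) [IsProbabilityMeasure μ] (g : Z → ℝ), Measurable g →
      (∀ z, g z ∈ Set.Icc (0 : ℝ) R) → Integrable g μ := by
    intro μ _ g hg hgR
    refine Integrable.of_bound hg.aestronglyMeasurable R (Filter.Eventually.of_forall ?_)
    intro z
    rw [Real.norm_eq_abs, abs_of_nonneg (hgR z).1]
    exact (hgR z).2
  have i1 := key P π hπ hπR
  have i2 := key P πstar hsm hsR
  have j1 := (integrable_rnDeriv_smul_iff hQP).2 (key Q π hπ hπR)
  have j2 := (integrable_rnDeriv_smul_iff hQP).2 (key Q πstar hsm hsR)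
  rw [← integral_rnDeriv_smul hQP (f := π), ← integral_rnDeriv_smul hQP (f := πstar)]
  have h : ∫ z, ((Q.rnDeriv P z).toReal • π z - τ * π z) ∂P ≤
      ∫ z, ((Q.rnDeriv P z).toReal • πstar z - τ * πstar z) ∂P := by
    refine integral_mono (j1.sub (i1.const_mul τ)) (j2.sub (i2.const_mul τ)) ?_
    intro z
    have hz := hπR z
    simp only [smul_eq_mul, hπstar]
    split_ifs with h1 h2
    · nlinarith [hz.2]
    · rw [h2]; simp
    · nlinarith [hz.1, not_lt.1 h1]
  rw [integral_sub j1 (i1.const_mul τ), integral_sub j2 (i2.const_mul τ),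
    integral_const_mul, integral_const_mul, hfee] at h
  nlinarith [mul_le_mul_of_nonneg_left hle hτ]
end
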